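/- arXiv:2512.07685 — 3 statements merged into one kernel-verified Lean document; each statement's English description precedes it below -/
import Mathlib

section
/- Let (Q, ≤, ·) be a monoidal well quasi-order with the +-property and neutral element e, and let I be a prime ideal of Q. Then either I = (prim(Q) ∩ I)*, or I = {q ∈ Q : ∃ p ∈ prim(Q) ∩ I, q ≤ p} (the downward closure of the primes of Q lying in I). -/
/-- `x ≡ y`: the equivalence induced by a quasi-order. -/
def Equi {Q : Type*} (le : Q → Q → Prop) (x y : Q) : Prop := le x y ∧ le y x

/-- `p` is prime: not equivalent to the neutral element `e`, and
`p ≡ a·b` implies `p ≡ a` or `p ≡ b`. -/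
def PrimeEl {Q : Type*} (le : Q → Q → Prop) (mul : Q → Q → Q) (e : Q) (p : Q) : Prop :=
  ¬ Equi le p e ∧ ∀ a b : Q, Equi le p (mul a b) → Equi le p a ∨ Equi le p b

/-- The product of a finite list of elements, with the empty product being `e`. -/
def ProdL {Q : Type*} (mul : Q → Q → Q) (e : Q) : List Q → Q
  | [] => e
  | [a] => a
  | a :: b :: rest => mul a (ProdL mul e (b :: rest))

/-- `A*`: the set of elements equivalent to finite products of elements of `A`,
with the empty product being `e`. -/
def StarSet {Q : Type*} (le : Q → Q → Prop) (mul : Q → Q → Q) (e : Q) (A : Set Q) :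
    Set Q :=
  {q : Q | ∃ l : List Q, (∀ a ∈ l, a ∈ A) ∧ Equi le q (ProdL mul e l)}

/-- `D` is downward-closed with respect to `le`. -/
def DownCl {Q : Type*} (le : Q → Q → Prop) (D : Set Q) : Prop :=
  ∀ q d, le q d → d ∈ D → q ∈ D

/-- An ideal: a nonempty, downward-closed, upward-directed subset. -/
def IdealSet {Q : Type*} (le : Q → Q → Prop) (S : Set Q) : Prop :=
  S.Nonempty ∧ DownCl le S ∧ ∀ a ∈ S, ∀ b ∈ S, ∃ c ∈ S, le a c ∧ le b c

/-- The product `A•B` of two subsets of a multiplicative quasi-order. -/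
def Bullet {Q : Type*} (le : Q → Q → Prop) (mul : Q → Q → Q) (A B : Set Q) : Set Q :=
  {z : Q | ∃ a ∈ A, ∃ b ∈ B, le z (mul a b)}

/-- A prime ideal: an ideal different from the downward closure of `e` such that
`I = J•K` implies `I = J` or `I = K` for all ideals `J`, `K`. -/
def PrimeIdeal {Q : Type*} (le : Q → Q → Prop) (mul : Q → Q → Q) (e : Q)
    (I : Set Q) : Prop :=
  IdealSet le I ∧ I ≠ {x : Q | le x e} ∧
    ∀ J K : Set Q, IdealSet le J → IdealSet le K → I = Bullet le mul J K →
      I = J ∨ I = K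

/-- The laws of a monoidal quasi-order with neutral element `e`. -/
structure IsMonoidalQO {Q : Type*} (le : Q → Q → Prop) (mul : Q → Q → Q) (e : Q) : Prop where
  refl : ∀ x, le x x
  trans : ∀ {x y z}, le x y → le y z → le x z
  assoc : ∀ p q r, Equi le (mul (mul p q) r) (mul p (mul q r))
  incr : ∀ q p, le q (mul q p)
  mono : ∀ {q p q' p'}, le q q' → le p p' → le (mul q p) (mul q' p')
  neut : ∀ q, Equi le (mul e q) q ∧ Equi le (mul q e) q

namespace IsMonoidalQO

variable {Q : Type*} {le : Q → Q → Prop} {mul : Q → Q → Q} {e : Q}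

theorem e_le (h : IsMonoidalQO le mul e) (q : Q) : le e q :=
  h.trans (h.incr e q) (h.neut q).1.1

theorem le_mul_left (h : IsMonoidalQO le mul e) (q p : Q) : le q (mul p q) :=
  h.trans (h.neut q).1.2 (h.mono (h.e_le p) (h.refl q))

theorem equi_trans (h : IsMonoidalQO le mul e) {x y z : Q} (hxy : Equi le x y)
    (hyz : Equi le y z) : Equi le x z :=
  ⟨h.trans hxy.1 hyz.1, h.trans hyz.2 hxy.2⟩

theorem equi_mul (h : IsMonoidalQO le mul e) {x y x' y' : Q} (hx : Equi le x x')
    (hy : Equi le y y') : Equi le (mul x y) (mul x' y') :=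
  ⟨h.mono hx.1 hy.1, h.mono hx.2 hy.2⟩

theorem prodL_cons (h : IsMonoidalQO le mul e) (a : Q) (l : List Q) :
    Equi le (ProdL mul e (a :: l)) (mul a (ProdL mul e l)) := by
  cases l with
  | nil => exact ⟨(h.neut a).2.2, (h.neut a).2.1⟩
  | cons b l => exact ⟨h.refl _, h.refl _⟩

theorem prodL_append (h : IsMonoidalQO le mul e) (l m : List Q) :
    Equi le (ProdL mul e (l ++ m)) (mul (ProdL mul e l) (ProdL mul e m)) := by
  induction l with
  | nil => exact (h.neut _).1.symm
  | cons a l ih =>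
    refine h.equi_trans (h.prodL_cons a (l ++ m)) ?_
    refine h.equi_trans (h.equi_mul ⟨h.refl a, h.refl a⟩ ih) ?_
    refine h.equi_trans (h.assoc _ _ _).symm ?_
    exact h.equi_mul (h.prodL_cons a l).symm ⟨h.refl _, h.refl _⟩

theorem le_prodL (h : IsMonoidalQO le mul e) {l : List Q} {a : Q} (ha : a ∈ l) :
    le a (ProdL mul e l) := by
  induction l with
  | nil => simp at ha
  | cons b l ih =>
    refine h.trans ?_ (h.prodL_cons b l).2
    rcases List.mem_cons.1 ha with rfl | ha
    · exact h.incr _ _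
    · exact h.trans (ih ha) (h.le_mul_left _ _)

/-- In a monoidal well quasi-order every element is a finite product of primes. -/
theorem exists_prime_factorization (h : IsMonoidalQO le mul e)
    (hwqo : ∀ f : ℕ → Q, ∃ i j, i < j ∧ le (f i) (f j)) (q : Q) :
    ∃ l : List Q, (∀ a ∈ l, PrimeEl le mul e a) ∧ Equi le q (ProdL mul e l) := by
  have hwf : WellFounded (fun x y : Q => le x y ∧ ¬ le y x) := by
    rw [wellFounded_iff_isEmpty_descending_chain]
    refine ⟨fun ⟨f, hf⟩ => ?_⟩
    obtain ⟨i, j, hij, hle⟩ := hwqo f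
    obtain ⟨k, rfl⟩ := Nat.exists_eq_add_of_lt hij
    have hdesc : ∀ k, le (f (i + 1 + k)) (f (i + 1)) := by
      intro k
      induction k with
      | zero => exact h.refl _
      | succ k ih => exact h.trans (hf (i + 1 + k)).1 ih
    refine (hf i).2 (h.trans hle ?_)
    have := hdesc k
    rwa [show i + 1 + k = i + k + 1 by omega] at this
  induction q using hwf.induction with
  | _ q ih =>
    by_cases hqe : Equi le q e
    · exact ⟨[], by simp, hqe⟩
    by_cases hp : PrimeEl le mul e q
    · exact ⟨[q], by simpa using hp, h.refl _, h.refl _⟩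
    have hsplit : ∃ a b, Equi le q (mul a b) ∧ ¬ Equi le q a ∧ ¬ Equi le q b := by
      by_contra! hcon
      refine hp ⟨hqe, fun a b hab => ?_⟩
      by_contra! hne
      exact hne.2 (hcon a b hab hne.1)
    obtain ⟨a, b, hab, hna, hnb⟩ := hsplit
    have haq : le a q := h.trans (h.incr a b) hab.2
    have hbq : le b q := h.trans (h.le_mul_left b a) hab.2
    obtain ⟨l, hl, hal⟩ := ih a ⟨haq, fun hqa => hna ⟨hqa, haq⟩⟩
    obtain ⟨m, hm, hbm⟩ := ih b ⟨hbq, fun hqb => hnb ⟨hqb, hbq⟩⟩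
    refine ⟨l ++ m, fun c hc => (List.mem_append.1 hc).elim (hl c) (hm c), ?_⟩
    exact h.equi_trans hab (h.equi_trans (h.equi_mul hal hbm) (h.prodL_append l m).symm)

/-- A product of elements not above `w` that is not above `w·w` can be regrouped into three
factors not above `w`. -/
theorem exists_three_factors (h : IsMonoidalQO le mul e) {w : Q} (hw : ¬ le w e) (l : List Q)
    (hl : ∀ a ∈ l, ¬ le w a) (hww : ¬ le (mul w w) (ProdL mul e l)) :
    ∃ a b c, ¬ le w a ∧ ¬ le w b ∧ ¬ le w c ∧
      Equi le (ProdL mul e l) (mul a (mul b c)) := by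
  induction l with
  | nil =>
    exact ⟨e, e, e, hw, hw, hw,
      (h.equi_trans (h.neut _).1 (h.neut e).1).symm⟩
  | cons p l ih =>
    have hcons := h.prodL_cons p l
    obtain ⟨a, b, c, ha, hb, hc, habc⟩ := ih (fun a ha => hl a (List.mem_cons_of_mem _ ha))
      (fun hle => hww (h.trans hle (h.trans (h.le_mul_left _ p) hcons.2)))
    have hx := h.equi_trans hcons (h.equi_mul ⟨h.refl p, h.refl p⟩ habc)
    have hx' := h.equi_trans hx (h.assoc p a (mul b c)).symm
    by_cases hpa : le w (mul p a)
    · exact ⟨p, a, mul b c, hl p List.mem_cons_self, ha,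
        fun hbc => hww (h.trans (h.mono hpa hbc) hx'.2), hx⟩
    · exact ⟨mul p a, b, c, hpa, hb, hc, hx'⟩

end IsMonoidalQO

/-- In a well quasi-order strict inclusion of downward-closed sets is well-founded. -/
theorem wellFounded_ssubset_downCl {P : Type*} {r : P → P → Prop} (hwqo : WellQuasiOrdered r) :
    WellFounded (fun S T : {S : Set P // DownCl r S} => S.1 ⊂ T.1) := by
  rw [wellFounded_iff_isEmpty_descending_chain]
  refine ⟨fun ⟨f, hf⟩ => ?_⟩
  choose t ht htn using fun n => Set.exists_of_ssubset (hf n)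
  obtain ⟨i, j, hij, hle⟩ := hwqo t
  have hanti : Antitone fun n => (f n).1 := antitone_nat_of_succ_le fun n => (hf n).subset
  exact htn i ((f (i + 1)).2 _ _ hle (hanti hij (ht j)))

/-- A downward-closed subset of a well quasi-order whose image under a map `F` dominates an
ideal `I` contains an ideal with the same property. -/
theorem exists_ideal_dominating {P Q : Type*} {r : P → P → Prop} {le : Q → Q → Prop}
    [IsPreorder P r] (hle : ∀ {x y z}, le x y → le y z → le x z)
    (hwqo : WellQuasiOrdered r) (F : P → Q) {I : Set Q} (hI : IdealSet le I) {T : Set P}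
    (hT : DownCl r T) (hcof : ∀ x ∈ I, ∃ t ∈ T, le x (F t)) :
    ∃ S ⊆ T, IdealSet r S ∧ ∀ x ∈ I, ∃ t ∈ S, le x (F t) := by
  obtain ⟨S, ⟨hST, hS⟩, hmin⟩ := (wellFounded_ssubset_downCl hwqo).has_min
    {S | S.1 ⊆ T ∧ ∀ x ∈ I, ∃ t ∈ S.1, le x (F t)} ⟨⟨T, hT⟩, subset_rfl, hcof⟩
  have hforce : ∀ a ∈ S.1, ∃ x ∈ I, ∀ t ∈ S.1, le x (F t) → r a t := by
    intro a ha
    by_contra! hcon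
    let U : {S : Set P // DownCl r S} :=
      ⟨{t | t ∈ S.1 ∧ ¬ r a t}, fun q d hqd hd => ⟨S.2 q d hqd hd.1,
        fun haq => hd.2 (trans_of r haq hqd)⟩⟩
    refine hmin U ⟨fun t ht => hST ht.1, fun x hx => ?_⟩
      ⟨fun t ht => ht.1, fun hsub => (hsub ha).2 (refl_of r a)⟩
    obtain ⟨t, ht, hxt, hat⟩ := hcon x hx
    exact ⟨t, ⟨ht, hat⟩, hxt⟩
  refine ⟨S.1, hST, ⟨?_, S.2, fun a ha b hb => ?_⟩, hS⟩
  · obtain ⟨x, hx⟩ := hI.1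
    obtain ⟨t, ht, -⟩ := hS x hx
    exact ⟨t, ht⟩
  · obtain ⟨x, hx, hxa⟩ := hforce a ha
    obtain ⟨y, hy, hyb⟩ := hforce b hb
    obtain ⟨z, hz, hxz, hyz⟩ := hI.2.2 x hx y hy
    obtain ⟨t, ht, hzt⟩ := hS z hz
    exact ⟨t, ht, hxa t ht (hle hxz hzt), hyb t ht (hle hyz hzt)⟩

namespace IsMonoidalQO

variable {Q : Type*} {le : Q → Q → Prop} {mul : Q → Q → Q} {e : Q}

/-- A prime ideal of a monoidal well quasi-order each of whose elements is dominated by some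
`a·b ∈ I` with `a ∈ A`, `b ∈ B`, where `A` and `B` are downward-closed, is contained in `A` or
in `B`. -/
theorem subset_or_subset_of_primeIdeal (h : IsMonoidalQO le mul e) (hwqo : WellQuasiOrdered le)
    {I A B : Set Q} (hI : PrimeIdeal le mul e I) (hA : DownCl le A) (hB : DownCl le B)
    (hcov : ∀ x ∈ I, ∃ a ∈ A, ∃ b ∈ B, mul a b ∈ I ∧ le x (mul a b)) :
    I ⊆ A ∨ I ⊆ B := by
  obtain ⟨hid, -, hprime⟩ := hI
  have : IsPreorder Q le := { refl := h.refl, trans := fun _ _ _ => h.trans }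
  have : IsPreorder (Q × Q) fun s t => le s.1 t.1 ∧ le s.2 t.2 :=
    { refl := fun s => ⟨h.refl _, h.refl _⟩
      trans := fun _ _ _ hst htu => ⟨h.trans hst.1 htu.1, h.trans hst.2 htu.2⟩ }
  obtain ⟨S, hST, ⟨⟨s, hs⟩, hSdown, hSdir⟩, hS⟩ := exists_ideal_dominating (le := le) h.trans
    (hwqo.prod hwqo) (fun t : Q × Q => mul t.1 t.2) hid
    (T := {t | t.1 ∈ A ∧ t.2 ∈ B ∧ mul t.1 t.2 ∈ I})
    (fun s t hst ht => ⟨hA _ _ hst.1 ht.1, hB _ _ hst.2 ht.2.1,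
      hid.2.1 _ _ (h.mono hst.1 hst.2) ht.2.2⟩)
    (fun x hx => by
      obtain ⟨a, ha, b, hb, hab, hle⟩ := hcov x hx
      exact ⟨(a, b), ⟨ha, hb, hab⟩, hle⟩)
  have hfst : IdealSet le (Prod.fst '' S) := by
    refine ⟨⟨_, s, hs, rfl⟩, ?_, ?_⟩
    · rintro q _ hq ⟨t, ht, rfl⟩
      exact ⟨(q, t.2), hSdown _ t ⟨hq, h.refl _⟩ ht, rfl⟩
    · rintro _ ⟨t, ht, rfl⟩ _ ⟨u, hu, rfl⟩
      obtain ⟨v, hv, htv, huv⟩ := hSdir t ht u hu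
      exact ⟨v.1, ⟨v, hv, rfl⟩, htv.1, huv.1⟩
  have hsnd : IdealSet le (Prod.snd '' S) := by
    refine ⟨⟨_, s, hs, rfl⟩, ?_, ?_⟩
    · rintro q _ hq ⟨t, ht, rfl⟩
      exact ⟨(t.1, q), hSdown _ t ⟨h.refl _, hq⟩ ht, rfl⟩
    · rintro _ ⟨t, ht, rfl⟩ _ ⟨u, hu, rfl⟩
      obtain ⟨v, hv, htv, huv⟩ := hSdir t ht u hu
      exact ⟨v.2, ⟨v, hv, rfl⟩, htv.2, huv.2⟩
  have hprod : I = Bullet le mul (Prod.fst '' S) (Prod.snd '' S) := by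
    ext z
    constructor
    · intro hz
      obtain ⟨t, ht, hzt⟩ := hS z hz
      exact ⟨_, ⟨t, ht, rfl⟩, _, ⟨t, ht, rfl⟩, hzt⟩
    · rintro ⟨_, ⟨t, ht, rfl⟩, _, ⟨u, hu, rfl⟩, hz⟩
      obtain ⟨v, hv, htv, huv⟩ := hSdir t ht u hu
      exact hid.2.1 _ _ (h.trans hz (h.mono htv.1 huv.2)) (hST hv).2.2
  refine (hprime _ _ hfst hsnd hprod).imp (fun heq => ?_) (fun heq => ?_)
  · rw [heq]
    rintro _ ⟨t, ht, rfl⟩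
    exact (hST ht).1
  · rw [heq]
    rintro _ ⟨t, ht, rfl⟩
    exact (hST ht).2.1

/-- An ideal of a monoidal well quasi-order that is closed under products is generated by its
primes. -/
theorem eq_starSet_of_mul_mem (h : IsMonoidalQO le mul e) (hwqo : WellQuasiOrdered le)
    {I : Set Q} (hI : IdealSet le I) (hmul : ∀ a ∈ I, ∀ b ∈ I, mul a b ∈ I) :
    I = StarSet le mul e {p : Q | PrimeEl le mul e p ∧ p ∈ I} := by
  obtain ⟨⟨x, hx⟩, hdown, -⟩ := hI
  ext q
  constructor
  · intro hq
    obtain ⟨l, hl, hql⟩ := h.exists_prime_factorization hwqo q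
    exact ⟨l, fun a ha => ⟨hl a ha, hdown _ _ (h.trans (h.le_prodL ha) hql.2) hq⟩, hql⟩
  · rintro ⟨l, hl, hql⟩
    refine hdown _ _ hql.1 ?_
    clear hql
    induction l with
    | nil => exact hdown _ _ (h.e_le x) hx
    | cons a l ih =>
      exact hdown _ _ (h.prodL_cons a l).1 (hmul _ (hl a List.mem_cons_self).2 _
        (ih fun b hb => hl b (List.mem_cons_of_mem _ hb)))

/-- If a prime ideal of a monoidal well quasi-order is not closed under products, then each of
its elements lies below a prime of the ideal. -/
theorem exists_prime_ge_of_mul_notMem (h : IsMonoidalQO le mul e) (hwqo : WellQuasiOrdered le)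
    {I : Set Q} (hI : PrimeIdeal le mul e I) {u v q : Q} (hu : u ∈ I) (hv : v ∈ I)
    (huv : mul u v ∉ I) (hq : q ∈ I) :
    ∃ p, (PrimeEl le mul e p ∧ p ∈ I) ∧ le q p := by
  by_contra! hcon
  have hdown := hI.1.2.1
  obtain ⟨w₀, hw₀, huw, hvw⟩ := hI.1.2.2 u hu v hv
  obtain ⟨w, hw, hw₀w, hqw⟩ := hI.1.2.2 w₀ hw₀ q hq
  have hww : mul w w ∉ I := fun hmem =>
    huv (hdown _ _ (h.mono (h.trans huw hw₀w) (h.trans hvw hw₀w)) hmem)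
  have hwe : ¬ le w e := fun hle =>
    hww (hdown _ _ (h.trans (h.mono hle (h.refl w)) (h.neut w).1.1) hw)
  let D : Set Q := {x | ¬ le w x}
  have hD : DownCl le D := fun x y hxy hy hwx => hy (h.trans hwx hxy)
  let E : Set Q := {z | ∃ b ∈ D, ∃ c ∈ D, mul b c ∈ I ∧ le z (mul b c)}
  have hE : DownCl le E := fun x y hxy ⟨b, hb, c, hc, hbc, hy⟩ =>
    ⟨b, hb, c, hc, hbc, h.trans hxy hy⟩
  have hcov : ∀ x ∈ I, ∃ a ∈ D, ∃ b ∈ E, mul a b ∈ I ∧ le x (mul a b) := by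
    intro x hx
    obtain ⟨l, hl, hxl⟩ := h.exists_prime_factorization hwqo x
    have hlI : ProdL mul e l ∈ I := hdown _ _ hxl.2 hx
    obtain ⟨a, b, c, ha, hb, hc, habc⟩ := h.exists_three_factors hwe l
      (fun p hp hwp => hcon p ⟨hl p hp, hdown _ _ (h.le_prodL hp) hlI⟩ (h.trans hqw hwp))
      (fun hle => hww (hdown _ _ hle hlI))
    have habcI : mul a (mul b c) ∈ I := hdown _ _ habc.2 hlI
    exact ⟨a, ha, mul b c, ⟨b, hb, c, hc, hdown _ _ (h.le_mul_left _ a) habcI, h.refl _⟩,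
      habcI, h.trans hxl.1 habc.1⟩
  have hnot : ¬ I ⊆ D := fun hsub => hsub hw (h.refl w)
  rcases h.subset_or_subset_of_primeIdeal hwqo hI hD hE hcov with hsub | hsub
  · exact hnot hsub
  · exact (h.subset_or_subset_of_primeIdeal hwqo hI hD hD fun x hx => hsub hx).elim hnot hnot

end IsMonoidalQO

/-- In a monoidal wqo with the +-property, every prime ideal `I` is either
`(prim(Q) ∩ I)*` or the downward closure of `prim(Q) ∩ I`. -/
theorem stmt10 {Q : Type*} (le : Q → Q → Prop) (mul : Q → Q → Q) (e : Q)
    (hrefl : ∀ x, le x x)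
    (htrans : ∀ x y z, le x y → le y z → le x z)
    (hassoc : ∀ p q r, Equi le (mul (mul p q) r) (mul p (mul q r)))
    (hincr : ∀ q p, le q (mul q p))
    (hmono : ∀ q p q' p', le q q' → le p p' → le (mul q p) (mul q' p'))
    (hneut : ∀ q, Equi le (mul e q) q ∧ Equi le (mul q e) q)
    (hplus : ∀ a b c, le c (mul a b) →
      ∃ a' b', le a' a ∧ le b' b ∧ Equi le c (mul a' b'))
    (hwqo : ∀ f : ℕ → Q, ∃ i j, i < j ∧ le (f i) (f j))
    (I : Set Q) (hI : PrimeIdeal le mul e I) :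
    I = StarSet le mul e {p : Q | PrimeEl le mul e p ∧ p ∈ I} ∨
    I = {q : Q | ∃ p, (PrimeEl le mul e p ∧ p ∈ I) ∧ le q p} := by
  have h : IsMonoidalQO le mul e :=
    ⟨hrefl, fun hxy hyz => htrans _ _ _ hxy hyz, hassoc, hincr,
      fun hq hp => hmono _ _ _ _ hq hp, hneut⟩
  by_cases hmul : ∀ a ∈ I, ∀ b ∈ I, mul a b ∈ I
  · exact Or.inl (h.eq_starSet_of_mul_mem hwqo hI.1 hmul)
  · push Not at hmul
    obtain ⟨u, hu, v, hv, huv⟩ := hmul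
    refine Or.inr (Set.Subset.antisymm
      (fun q hq => h.exists_prime_ge_of_mul_notMem hwqo hI hu hv huv hq) ?_)
    rintro q ⟨p, ⟨-, hp⟩, hqp⟩
    exact hI.1.2.1 _ _ hqp hp
end

section
/- Let (Q, ≤, ·) be an abstractly Higman monoidal well-founded quasi-order, let P_i be its set of idempotent primes (primes p with p·p ≡ p) and P_n its set of non-idempotent primes. Then: (1) every element of Q is ≡-equivalent to a finite product of primes; (2) for all finite sequences (p₀,…,p_{n−1}) and (q₀,…,q_{m−1}) of primes of Q, (p₀,…,p_{n−1}) ≤_H (q₀,…,q_{m−1}) in the generalized Higman ordering H(P_n ∪ P_i, P_n, P_i) if and only if p₀·…·p_{n−1} ≤ q₀·…·q_{m−1} in Q. Consequently, the quotient of H(P_n ∪ P_i, P_n, P_i) by ≡_H is order-isomorphic to the quotient of Q by ≡. -/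
/-- A monoidal qo is abstractly Higman if products of primes compare exactly via
weakly increasing maps that only collapse indices at idempotent primes. -/
def AbsHig {Q : Type*} (le : Q → Q → Prop) (mul : Q → Q → Q) (e : Q) : Prop :=
  ∀ (n m : ℕ) (p : Fin (n + 1) → Q) (q : Fin (m + 1) → Q),
    (∀ i, PrimeEl le mul e (p i)) → (∀ j, PrimeEl le mul e (q j)) →
    (le (ProdL mul e (List.ofFn p)) (ProdL mul e (List.ofFn q)) ↔
      ∃ h : Fin (n + 1) → Fin (m + 1), Monotone h ∧ (∀ i, le (p i) (q (h i))) ∧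
        ∀ j, (∃ i i', i ≠ i' ∧ h i = j ∧ h i' = j) → Equi le (mul (q j) (q j)) (q j))

/-- The generalized Higman ordering on finite sequences over a qo `(P, leP)`,
where collapsing several indices to `j` is allowed only if `v j ∈ Pi`. -/
def HigLE {P : Type*} (leP : P → P → Prop) (Pi : Set P) (u v : List P) : Prop :=
  ∃ f : Fin u.length → Fin v.length, Monotone f ∧
    (∀ i, leP (u.get i) (v.get (f i))) ∧
    ∀ j, (∃ i i', i ≠ i' ∧ f i = j ∧ f i' = j) → v.get j ∈ Pi

theorem Equi.symm {Q : Type*} {le : Q → Q → Prop} {x y : Q} (h : Equi le x y) : Equi le y x :=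
  ⟨h.2, h.1⟩

theorem Equi.trans {Q : Type*} {le : Q → Q → Prop}
    (htrans : ∀ x y z, le x y → le y z → le x z) {x y z : Q}
    (h₁ : Equi le x y) (h₂ : Equi le y z) : Equi le x z :=
  ⟨htrans _ _ _ h₁.1 h₂.1, htrans _ _ _ h₂.2 h₁.2⟩

theorem Equi.mul {Q : Type*} {le : Q → Q → Prop} {mul : Q → Q → Q}
    (hmono : ∀ q p q' p', le q q' → le p p' → le (mul q p) (mul q' p'))
    {a b c d : Q} (h₁ : Equi le a c) (h₂ : Equi le b d) : Equi le (mul a b) (mul c d) :=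
  ⟨hmono _ _ _ _ h₁.1 h₂.1, hmono _ _ _ _ h₁.2 h₂.2⟩

theorem prodL_cons_equi {Q : Type*} {le : Q → Q → Prop} {mul : Q → Q → Q} {e : Q}
    (hrefl : ∀ x, le x x) (hneut : ∀ q, Equi le (mul e q) q ∧ Equi le (mul q e) q)
    (a : Q) (l : List Q) : Equi le (ProdL mul e (a :: l)) (mul a (ProdL mul e l)) := by
  cases l with
  | nil => exact (hneut a).2.symm
  | cons b l => exact ⟨hrefl _, hrefl _⟩

theorem prodL_append_equi {Q : Type*} {le : Q → Q → Prop} {mul : Q → Q → Q} {e : Q}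
    (hrefl : ∀ x, le x x) (htrans : ∀ x y z, le x y → le y z → le x z)
    (hassoc : ∀ p q r, Equi le (mul (mul p q) r) (mul p (mul q r)))
    (hmono : ∀ q p q' p', le q q' → le p p' → le (mul q p) (mul q' p'))
    (hneut : ∀ q, Equi le (mul e q) q ∧ Equi le (mul q e) q) (u v : List Q) :
    Equi le (ProdL mul e (u ++ v)) (mul (ProdL mul e u) (ProdL mul e v)) := by
  induction u with
  | nil => exact (hneut _).1.symm
  | cons a u ih =>
    have hself (x : Q) : Equi le x x := ⟨hrefl x, hrefl x⟩
    exact (prodL_cons_equi hrefl hneut a (u ++ v)).trans htrans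
      (((hself a).mul hmono ih).trans htrans
        ((hassoc _ _ _).symm.trans htrans
          ((prodL_cons_equi hrefl hneut a u).symm.mul hmono (hself _))))

theorem neutral_le {Q : Type*} {le : Q → Q → Prop} {mul : Q → Q → Q} {e : Q}
    (htrans : ∀ x y z, le x y → le y z → le x z) (hincr : ∀ q p, le q (mul q p))
    (hneut : ∀ q, Equi le (mul e q) q ∧ Equi le (mul q e) q) (a : Q) : le e a :=
  htrans _ _ _ (hincr e a) (hneut a).1.1

/-- In a well-founded monoidal quasi-order every element is equivalent to a product of primes. -/
theorem exists_prime_factorization {Q : Type*} {le : Q → Q → Prop} {mul : Q → Q → Q} {e : Q}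
    (hrefl : ∀ x, le x x) (htrans : ∀ x y z, le x y → le y z → le x z)
    (hassoc : ∀ p q r, Equi le (mul (mul p q) r) (mul p (mul q r)))
    (hincr : ∀ q p, le q (mul q p))
    (hmono : ∀ q p q' p', le q q' → le p p' → le (mul q p) (mul q' p'))
    (hneut : ∀ q, Equi le (mul e q) q ∧ Equi le (mul q e) q)
    (hwf : WellFounded (fun x y => le x y ∧ ¬ le y x)) (x : Q) :
    ∃ l : List Q, (∀ p ∈ l, PrimeEl le mul e p) ∧ Equi le x (ProdL mul e l) := by
  induction x using hwf.induction with
  | h x ih =>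
    by_cases hxe : Equi le x e
    · exact ⟨[], by simp, hxe⟩
    by_cases hx : PrimeEl le mul e x
    · exact ⟨[x], by simpa using hx, hrefl x, hrefl x⟩
    obtain ⟨a, b, hab, hxa, hxb⟩ :
        ∃ a b, Equi le x (mul a b) ∧ ¬ Equi le x a ∧ ¬ Equi le x b := by
      simpa [PrimeEl, hxe] using hx
    have hax : le a x := htrans _ _ _ (hincr a b) hab.2
    have hbx : le b x := htrans _ _ _ (hneut b).1.2 (htrans _ _ _
      (hmono _ _ _ _ (neutral_le htrans hincr hneut a) (hrefl b)) hab.2)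
    obtain ⟨u, hu, hau⟩ := ih a ⟨hax, fun h => hxa ⟨h, hax⟩⟩
    obtain ⟨v, hv, hbv⟩ := ih b ⟨hbx, fun h => hxb ⟨h, hbx⟩⟩
    refine ⟨u ++ v, fun p hp => (List.mem_append.1 hp).elim (hu p) (hv p), ?_⟩
    exact hab.trans htrans ((hau.mul hmono hbv).trans htrans
      (prodL_append_equi hrefl htrans hassoc hmono hneut u v).symm)

theorem higLE_iff_prodL_le {Q : Type*} {le : Q → Q → Prop} {mul : Q → Q → Q} {e : Q}
    (hrefl : ∀ x, le x x) (htrans : ∀ x y z, le x y → le y z → le x z)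
    (hincr : ∀ q p, le q (mul q p))
    (hneut : ∀ q, Equi le (mul e q) q ∧ Equi le (mul q e) q)
    (hhig : AbsHig le mul e) (u v : List Q)
    (hu : ∀ p ∈ u, PrimeEl le mul e p) (hv : ∀ p ∈ v, PrimeEl le mul e p) :
    HigLE le {p : Q | PrimeEl le mul e p ∧ Equi le (mul p p) p} u v ↔
      le (ProdL mul e u) (ProdL mul e v) := by
  match u, v with
  | [], v =>
    exact ⟨fun _ => neutral_le htrans hincr hneut _, fun _ =>
      ⟨Fin.elim0, fun i => i.elim0, fun i => i.elim0, fun _ ⟨i, _⟩ => i.elim0⟩⟩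
  | a :: u, [] =>
    refine ⟨fun ⟨f, _⟩ => (f ⟨0, by simp⟩).elim0, fun h => ?_⟩
    refine absurd ⟨?_, neutral_le htrans hincr hneut a⟩ (hu a (by simp)).1
    exact htrans _ _ _ (htrans _ _ _ (hincr a _) (prodL_cons_equi hrefl hneut a u).2) h
  | a :: u, b :: v =>
    have hprime : ∀ j, PrimeEl le mul e ((b :: v).get j) := fun j => hv _ (List.get_mem _ j)
    have key := hhig u.length v.length (a :: u).get (b :: v).get
      (fun i => hu _ (List.get_mem (a :: u) i)) hprime
    have hofu : List.ofFn (n := u.length + 1) (a :: u).get = a :: u := List.ofFn_get (a :: u)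
    have hofv : List.ofFn (n := v.length + 1) (b :: v).get = b :: v := List.ofFn_get (b :: v)
    rw [hofu, hofv] at key
    rw [key]
    exact ⟨fun ⟨f, hf, hle, hid⟩ => ⟨f, hf, hle, fun j hj => (hid j hj).2⟩,
      fun ⟨f, hf, hle, hid⟩ => ⟨f, hf, hle, fun j hj => ⟨hprime j, hid j hj⟩⟩⟩

/-- In an abstractly Higman monoidal well-founded qo: (1) every element is
equivalent to a finite product of primes; (2) the comparison of products of primes
coincides with the generalized Higman ordering `H(P_n ∪ P_i, P_n, P_i)` on the
sequences of primes (with `P_i` the idempotent primes); (3) consequently the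
quotient of that generalized Higman ordering by `≡_H` is order-isomorphic to the
quotient of `Q` by `≡`. -/
theorem stmt14 {Q : Type*} (le : Q → Q → Prop) (mul : Q → Q → Q) (e : Q)
    (hrefl : ∀ x, le x x)
    (htrans : ∀ x y z, le x y → le y z → le x z)
    (hassoc : ∀ p q r, Equi le (mul (mul p q) r) (mul p (mul q r)))
    (hincr : ∀ q p, le q (mul q p))
    (hmono : ∀ q p q' p', le q q' → le p p' → le (mul q p) (mul q' p'))
    (hneut : ∀ q, Equi le (mul e q) q ∧ Equi le (mul q e) q)
    (hwf : WellFounded (fun x y => le x y ∧ ¬ le y x))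
    (hhig : AbsHig le mul e)
    (Pidem : Set Q) (hPidem : Pidem = {p : Q | PrimeEl le mul e p ∧ Equi le (mul p p) p}) :
    -- (1) every element is ≡-equivalent to a finite product of primes
    (∀ x : Q, ∃ l : List Q, (∀ p ∈ l, PrimeEl le mul e p) ∧ Equi le x (ProdL mul e l)) ∧
    -- (2) on sequences of primes, ≤_H coincides with ≤ on the products
    (∀ u v : List Q, (∀ p ∈ u, PrimeEl le mul e p) → (∀ p ∈ v, PrimeEl le mul e p) →
      (HigLE le Pidem u v ↔ le (ProdL mul e u) (ProdL mul e v))) ∧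
    -- (3) the quotients are order-isomorphic: there is a map from sequences of
    -- primes to Q that is order-preserving and order-reflecting and surjective
    -- up to equivalence
    (∃ g : List Q → Q,
      (∀ u v : List Q, (∀ p ∈ u, PrimeEl le mul e p) → (∀ p ∈ v, PrimeEl le mul e p) →
        (HigLE le Pidem u v ↔ le (g u) (g v))) ∧
      (∀ q : Q, ∃ u : List Q, (∀ p ∈ u, PrimeEl le mul e p) ∧ Equi le (g u) q)) := by
  subst hPidem
  have hfactor := exists_prime_factorization hrefl htrans hassoc hincr hmono hneut hwf
  have hcompare := higLE_iff_prodL_le hrefl htrans hincr hneut hhig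
  refine ⟨hfactor, hcompare, ProdL mul e, hcompare, fun q => ?_⟩
  obtain ⟨u, hu, hqu⟩ := hfactor q
  exact ⟨u, hu, hqu.symm⟩
end

section
/- Let (P, ≤_P) be a quasi-order, P_n ⊆ P downward-closed and P_i = P ∖ P_n. In the monoidal quasi-order H(P, P_n, P_i), the idempotent primes are exactly the sequences that are ≡_H-equivalent to a one-element sequence ⟨p⟩ with p ∈ P_i; that is, a prime u satisfies u⌢u ≡_H u if and only if u ≡_H ⟨p⟩ for some p ∈ P_i. -/
/-- The equivalence induced by the generalized Higman ordering. -/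
def HigEquiv {P : Type*} (leP : P → P → Prop) (Pi : Set P) (u v : List P) : Prop :=
  HigLE leP Pi u v ∧ HigLE leP Pi v u

/-- A sequence is prime in `H(P, P_n, P_i)` if it is not equivalent to the empty
sequence and `u ≡_H v⌢w` implies `u ≡_H v` or `u ≡_H w`. -/
def HigPrime {P : Type*} (leP : P → P → Prop) (Pi : Set P) (u : List P) : Prop :=
  ¬ HigEquiv leP Pi u [] ∧
    ∀ v w : List P, HigEquiv leP Pi u (v ++ w) → HigEquiv leP Pi u v ∨ HigEquiv leP Pi u w

section HigmanOrder

variable {P : Type*} {leP : P → P → Prop} {Pi : Set P}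

theorem HigLE.refl (hrefl : ∀ x, leP x x) (u : List P) : HigLE leP Pi u u :=
  ⟨id, monotone_id, fun _ => hrefl _, fun _ ⟨_, _, hne, h, h'⟩ => absurd (h.trans h'.symm) hne⟩

theorem HigLE.trans (htrans : ∀ x y z, leP x y → leP y z → leP x z)
    (hup : ∀ x y, leP x y → x ∈ Pi → y ∈ Pi) {u v w : List P}
    (huv : HigLE leP Pi u v) (hvw : HigLE leP Pi v w) : HigLE leP Pi u w := by
  obtain ⟨f, hf, hfle, hfPi⟩ := huv
  obtain ⟨g, hg, hgle, hgPi⟩ := hvw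
  refine ⟨g ∘ f, hg.comp hf, fun i => htrans _ _ _ (hfle i) (hgle (f i)), ?_⟩
  rintro j ⟨i, i', hne, rfl, h⟩
  by_cases hff : f i = f i'
  · exact hup _ _ (hgle (f i)) (hfPi _ ⟨i, i', hne, rfl, hff.symm⟩)
  · exact hgPi _ ⟨f i, f i', hff, rfl, h⟩

theorem HigLE.append_right (hrefl : ∀ x, leP x x) (u v : List P) : HigLE leP Pi u (u ++ v) := by
  refine ⟨Fin.castLE (by simp), fun _ _ h => h, fun i => ?_, ?_⟩
  · simpa using hrefl _
  · rintro _ ⟨i, i', hne, rfl, h⟩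
    exact absurd (Fin.castLE_injective _ h).symm hne

theorem HigLE.le_of_mem {u : List P} {p x : P} (h : HigLE leP Pi u [p]) (hx : x ∈ u) :
    leP x p := by
  obtain ⟨f, -, hle, -⟩ := h
  obtain ⟨i, rfl⟩ := List.mem_iff_get.1 hx
  simpa using hle i

theorem HigLE.singleton {u : List P} {p : P} (hp : p ∈ Pi) (h : ∀ x ∈ u, leP x p) :
    HigLE leP Pi u [p] :=
  ⟨fun _ => ⟨0, by simp⟩, monotone_const, fun i => h _ (u.get_mem i), fun j _ => by simpa using hp⟩

/-- A sequence with at least two entries lies below `⟨p⟩` only if `p ∈ P_i`. -/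
theorem HigLE.mem_of_two_le_length {u : List P} {p : P} (h : HigLE leP Pi u [p])
    (hu : 2 ≤ u.length) : p ∈ Pi := by
  obtain ⟨f, -, -, hPi⟩ := h
  have := hPi (f ⟨0, by omega⟩)
    ⟨⟨0, by omega⟩, ⟨1, by omega⟩, by simp, rfl, Subsingleton.elim (α := Fin 1) _ _⟩
  simpa using this

/-- A prime sequence is equivalent to a one-element sequence. -/
theorem HigPrime.exists_equiv_singleton {u : List P} (hu : HigPrime leP Pi u) {v : List P}
    (huv : HigEquiv leP Pi u v) : ∃ p, HigEquiv leP Pi u [p] := by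
  induction v with
  | nil => exact absurd huv hu.1
  | cons a w ih =>
    rcases hu.2 [a] w huv with h | h
    · exact ⟨a, h⟩
    · exact ih h

end HigmanOrder

/-- In `H(P, P_n, P_i)`, a prime `u` is idempotent (`u⌢u ≡_H u`) iff it is
`≡_H`-equivalent to a one-element sequence `⟨p⟩` with `p ∈ P_i`. -/
theorem stmt16 {P : Type*} (leP : P → P → Prop)
    (hrefl : ∀ x, leP x x)
    (htrans : ∀ x y z, leP x y → leP y z → leP x z)
    (Pn : Set P) (hPn : ∀ q d, leP q d → d ∈ Pn → q ∈ Pn)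
    (Pi : Set P) (hPi : Pi = Pnᶜ) :
    ∀ u : List P, HigPrime leP Pi u →
      (HigEquiv leP Pi (u ++ u) u ↔ ∃ p ∈ Pi, HigEquiv leP Pi u [p]) := by
  intro u hu
  have hup : ∀ x y, leP x y → x ∈ Pi → y ∈ Pi := by
    subst hPi
    exact fun x y hxy hx hy => hx (hPn x y hxy hy)
  have hne : u ≠ [] := by
    rintro rfl
    exact hu.1 ⟨HigLE.refl hrefl [], HigLE.refl hrefl []⟩
  constructor
  · intro h
    obtain ⟨p, hp⟩ := hu.exists_equiv_singleton ⟨HigLE.refl hrefl u, HigLE.refl hrefl u⟩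
    refine ⟨p, (HigLE.trans htrans hup h.1 hp.1).mem_of_two_le_length ?_, hp⟩
    have := List.length_pos_iff.2 hne
    simp only [List.length_append]
    omega
  · rintro ⟨p, hp, hle, hpu⟩
    refine ⟨HigLE.trans htrans hup (HigLE.singleton hp fun x hx => ?_) hpu,
      HigLE.append_right hrefl u u⟩
    exact hle.le_of_mem (by simpa using hx)
end
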